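/- Fix an integer C ≥ 3. Let n = n(ν) and N = N(ν) be sequences of positive integers with N → ∞, n ≤ CN − 1, CN − n = o(N), and λ_0 = o(N^{1/7}), where λ_0 = λ_0(n/N) is the unique positive solution of λ g′(λ)/g(λ) = n/N. Set μ_1 = N λ_0^{C−1}/(g(λ_0)(C−1)!) and μ_2 = N λ_0^{C−2}/(g(λ_0)(C−2)!), and define the 2×2 matrix A_ν = ( λ_0^{3/2} / ( 3 √(5 C(C−1)(C−2) N) ) ) · [ [ 1 + 12√(C−2)/(5√λ_0), 2 − 6√(C−2)/(5√λ_0) ], [ 2 − 6√(C−2)/(5√λ_0), 4 + 3√(C−2)/(5√λ_0) ] ]. Then, in the uniform allocation model, the random vector A_ν · ( (X_{C−1}, X_{C−2}) − (μ_1, μ_2) ) converges in distribution to the standard 2-dimensional normal distribution N(0, I_2). -/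

import Mathlib

open MeasureTheory ProbabilityTheory Filter Finset Matrix
open scoped BigOperators

/-- The standard `r`-dimensional Gaussian measure `N(0, I_r)` on `Fin r → ℝ`. -/
noncomputable def stdGaussian (r : ℕ) : Measure (Fin r → ℝ) :=
  Measure.pi fun _ => gaussianReal 0 1

/-- Placements of `n` distinguishable balls into `N` distinguishable bins with
no bin containing more than `C` balls. -/
def validPlacements (n N C : ℕ) : Finset (Fin n → Fin N) :=
  Finset.univ.filter fun f => ∀ j, (Finset.univ.filter fun i => f i = j).card ≤ C

/-- `binCount f m` is the number of bins containing exactly `m` balls under placement `f`. -/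
def binCount {n N : ℕ} (f : Fin n → Fin N) (m : ℕ) : ℕ :=
  (Finset.univ.filter fun j => (Finset.univ.filter fun i => f i = j).card = m).card

/-- `g(λ) = ∑_{k=0}^C λ^k / k!`. -/
noncomputable def gfun (C : ℕ) (x : ℝ) : ℝ :=
  ∑ k ∈ Finset.range (C + 1), x ^ k / (Nat.factorial k)

theorem tendsto_average_of_tendsto_charFun {α : ℕ → Type*} (S : ∀ ν, Finset (α ν))
    (hS : ∀ ν, (S ν).Nonempty) (x : ∀ ν, α ν → Fin 2 → ℝ)
    (h : ∀ a b : ℝ, Tendsto (fun ν => (∑ f ∈ S ν,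
        Complex.exp (((a * x ν f 0 + b * x ν f 1 : ℝ) : ℂ) * Complex.I)) / ((S ν).card : ℂ))
      atTop (nhds (Complex.exp (-((a : ℂ) ^ 2 + (b : ℂ) ^ 2) / 2))))
    (φ : BoundedContinuousFunction (Fin 2 → ℝ) ℝ) :
    Tendsto (fun ν => (∑ f ∈ S ν, φ (x ν f)) / ((S ν).card : ℝ)) atTop
      (nhds (∫ y, φ y ∂_root_.stdGaussian 2)) := by
  have hpos : ∀ ν, ((S ν).card : ℝ) ≠ 0 := fun ν => by
    exact_mod_cast (Finset.card_pos.2 (hS ν)).ne'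
  set m : ∀ ν, Measure (EuclideanSpace ℝ (Fin 2)) := fun ν =>
    ENNReal.ofReal ((S ν).card : ℝ)⁻¹ • ∑ f ∈ S ν, Measure.dirac (WithLp.toLp 2 (x ν f)) with hm
  have hprob : ∀ ν, IsProbabilityMeasure (m ν) := fun ν => by
    constructor
    have : ((S ν).card : ENNReal) = ENNReal.ofReal (S ν).card := by simp
    simp only [hm, Measure.smul_apply, Measure.coe_finsetSum, Finset.sum_apply, measure_univ,
      Finset.sum_const, nsmul_eq_mul, mul_one, smul_eq_mul]
    rw [this, ← ENNReal.ofReal_mul (by positivity), inv_mul_cancel₀ (hpos ν), ENNReal.ofReal_one]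
  have hint : ∀ {F : Type} [NormedAddCommGroup F] [NormedSpace ℝ F] [CompleteSpace F] (ν : ℕ)
      (g : EuclideanSpace ℝ (Fin 2) → F),
      ∫ y, g y ∂(m ν) = ((S ν).card : ℝ)⁻¹ • ∑ f ∈ S ν, g (WithLp.toLp 2 (x ν f)) := by
    intro F _ _ _ ν g
    simp only [hm]
    rw [integral_smul_measure, integral_finsetSum_measure]
    · simp [integral_dirac]
    · intro i _
      exact integrable_dirac (by simp)
  have hlim : IsProbabilityMeasure ((_root_.stdGaussian 2).map (WithLp.toLp 2)) := by
    have : IsProbabilityMeasure (_root_.stdGaussian 2) := by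
      unfold _root_.stdGaussian; infer_instance
    exact Measure.isProbabilityMeasure_map (by fun_prop)
  let P : ℕ → ProbabilityMeasure (EuclideanSpace ℝ (Fin 2)) := fun ν => ⟨m ν, hprob ν⟩
  let P₀ : ProbabilityMeasure (EuclideanSpace ℝ (Fin 2)) := ⟨_, hlim⟩
  have hconv : Tendsto P atTop (nhds P₀) := by
    refine ProbabilityMeasure.tendsto_of_tendsto_charFun fun t => ?_
    have h1 : charFun (P₀ : Measure _) t =
        Complex.exp (-((t 0 : ℂ) ^ 2 + (t 1 : ℂ) ^ 2) / 2) := by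
      change charFun ((_root_.stdGaussian 2).map (WithLp.toLp 2)) t = _
      rw [_root_.stdGaussian, charFun_pi]
      simp only [charFun_gaussianReal, Fin.prod_univ_two, ← Complex.exp_add]
      congr 1
      simp
      ring
    rw [h1]
    refine (h (t 0) (t 1)).congr fun ν => ?_
    change _ = charFun (m ν) t
    rw [charFun_apply, hint, div_eq_inv_mul]
    simp [PiLp.inner_apply, Fin.sum_univ_two, mul_comm]
  rw [ProbabilityMeasure.tendsto_iff_forall_integral_tendsto] at hconv
  have h2 := hconv (φ.compContinuous ⟨fun y => WithLp.ofLp y, by fun_prop⟩)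
  have h3 : ∫ y, φ.compContinuous ⟨fun y : EuclideanSpace ℝ (Fin 2) => WithLp.ofLp y,
      by fun_prop⟩ y ∂(P₀ : Measure _) = ∫ y, φ y ∂_root_.stdGaussian 2 := by
    change ∫ y, _ ∂((_root_.stdGaussian 2).map (WithLp.toLp 2)) = _
    rw [integral_map (by fun_prop) (by fun_prop)]
    simp
  rw [h3] at h2
  refine h2.congr fun ν => ?_
  change ∫ y, _ ∂(m ν) = _
  rw [hint, div_eq_inv_mul]
  simp

theorem sum_prod_card_fiber {R : Type*} [CommSemiring R] (n N : ℕ) (H : ℕ → R) :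
    ∑ f : Fin n → Fin N, ∏ j, H (Finset.univ.filter fun i => f i = j).card =
      ∑ k ∈ Finset.piAntidiag (Finset.univ : Finset (Fin N)) n,
        (Nat.multinomial Finset.univ k : R) * ∏ j, H (k j) := by
  classical
  have key : (∑ j : Fin N, (MvPolynomial.X j : MvPolynomial (Fin N) R)) ^ n =
      ∑ f : Fin n → Fin N, MvPolynomial.monomial (Finsupp.equivFunOnFinite.symm
        fun j => (Finset.univ.filter fun i => f i = j).card) (1 : R) := by
    have : (∑ j : Fin N, (MvPolynomial.X j : MvPolynomial (Fin N) R)) ^ n =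
        ∏ _i : Fin n, ∑ j : Fin N, (MvPolynomial.X j : MvPolynomial (Fin N) R) := by simp
    rw [this, Finset.prod_univ_sum, Fintype.piFinset_univ]
    refine Finset.sum_congr rfl fun f _ => ?_
    rw [MvPolynomial.monomial_eq, Finsupp.prod_fintype _ _ (by simp)]
    rw [map_one, one_mul, ← Finset.prod_fiberwise (s := Finset.univ) (g := f)]
    refine Finset.prod_congr rfl fun j _ => ?_
    rw [Finset.prod_congr rfl fun i hi => by rw [(Finset.mem_filter.1 hi).2], Finset.prod_const]
    simp
  rw [Finset.sum_pow_eq_sum_piAntidiag] at key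
  let Φ : MvPolynomial (Fin N) R →ₗ[R] R :=
    (MvPolynomial.basisMonomials (Fin N) R).constr R fun k => ∏ j, H (k j)
  have hΦ : ∀ k : Fin N →₀ ℕ, Φ (MvPolynomial.monomial k 1) = ∏ j, H (k j) := fun k => by
    have := (MvPolynomial.basisMonomials (Fin N) R).constr_basis R (fun k => ∏ j, H (k j)) k
    simpa [Φ] using this
  have h2 := congrArg Φ key
  rw [map_sum, map_sum] at h2
  simp only [hΦ] at h2
  rw [show (∑ f : Fin n → Fin N, ∏ j, H (Finset.univ.filter fun i => f i = j).card) = _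
    from h2.symm]
  refine Finset.sum_congr rfl fun k _ => ?_
  have h3 : (∏ j, (MvPolynomial.X j : MvPolynomial (Fin N) R) ^ k j) =
      MvPolynomial.monomial (Finsupp.equivFunOnFinite.symm k) 1 := by
    rw [MvPolynomial.monomial_eq, Finsupp.prod_fintype _ _ (by simp)]
    simp
  rw [h3, ← nsmul_eq_mul, map_nsmul, hΦ, nsmul_eq_mul]
  simp

theorem integral_exp_int_mul_eq (m : ℤ) :
    ∫ θ in (-Real.pi)..Real.pi, Complex.exp ((θ : ℂ) * (m : ℂ) * Complex.I) =
      if m = 0 then 2 * (Real.pi : ℂ) else 0 := by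
  split_ifs with hm
  · subst hm
    simp
    ring
  · have hc : (m : ℂ) * Complex.I ≠ 0 := by simp [hm]
    have h := integral_exp_mul_complex (a := -Real.pi) (b := Real.pi) hc
    have h1 : ∀ θ : ℝ, Complex.exp ((θ : ℂ) * (m : ℂ) * Complex.I) =
        Complex.exp ((m : ℂ) * Complex.I * θ) := fun θ => by ring_nf
    simp_rw [h1]
    have h2 : Complex.exp ((m : ℂ) * Complex.I * (Real.pi : ℝ)) =
        Complex.exp ((m : ℂ) * Complex.I * (-Real.pi : ℝ)) := by
      rw [Complex.exp_eq_exp_iff_exists_int]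
      exact ⟨m, by push_cast; ring⟩
    rw [h, h2, sub_self, zero_div]

theorem integral_pow_eq (C n N : ℕ) (hN : 0 < N) (w : ℕ → ℂ) :
    ∫ θ in (-Real.pi)..Real.pi, (∑ k ∈ Finset.range (C + 1),
        w k * Complex.exp (((θ * ((n : ℝ) / N - k) : ℝ) : ℂ) * Complex.I)) ^ N =
      2 * Real.pi * ∑ k ∈ (Finset.piAntidiag (Finset.univ : Finset (Fin N)) n).filter
        (fun k => ∀ j, k j ≤ C), ∏ j, w (k j) := by
  have h1 : ∀ θ : ℝ, (∑ k ∈ Finset.range (C + 1),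
        w k * Complex.exp (((θ * ((n : ℝ) / N - k) : ℝ) : ℂ) * Complex.I)) ^ N =
      ∑ k ∈ Fintype.piFinset (fun _ : Fin N => Finset.range (C + 1)),
        (∏ j, w (k j)) * Complex.exp ((θ : ℂ) * (((n : ℤ) - ∑ j, (k j : ℤ) : ℤ) : ℂ)
          * Complex.I) := by
    intro θ
    have : ∀ z : ℂ, z ^ N = ∏ _j : Fin N, z := fun z => by simp
    rw [this, Finset.prod_univ_sum]
    refine Finset.sum_congr rfl fun k _ => ?_
    rw [Finset.prod_mul_distrib, ← Complex.exp_sum]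
    congr 2
    rw [← Finset.sum_mul]
    congr 1
    push_cast
    rw [← Finset.mul_sum, Finset.sum_sub_distrib]
    have hN' : (N : ℂ) ≠ 0 := by exact_mod_cast hN.ne'
    simp only [Finset.sum_const, Finset.card_univ, Fintype.card_fin, nsmul_eq_mul]
    field_simp
  simp_rw [h1]
  rw [intervalIntegral.integral_finsetSum]
  swap
  · intro k _
    apply Continuous.intervalIntegrable
    fun_prop
  simp_rw [intervalIntegral.integral_const_mul, integral_exp_int_mul_eq, mul_ite, mul_zero]
  rw [← Finset.sum_filter, Finset.mul_sum]
  refine Finset.sum_congr ?_ fun k _ => by ring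
  ext k
  simp only [Finset.mem_filter, Fintype.mem_piFinset, Finset.mem_range, Nat.lt_succ_iff,
    Finset.mem_piAntidiag, Finset.mem_univ, implies_true, and_true]
  rw [and_comm, sub_eq_zero]
  refine and_congr ⟨fun h => ?_, fun h => ?_⟩ Iff.rfl
  · exact_mod_cast h.symm
  · exact_mod_cast h.symm

theorem integral_pow_eq_sum_validPlacements (C n N : ℕ) (hN : 0 < N) (x : ℂ) (G : ℕ → ℂ) :
    ∫ θ in (-Real.pi)..Real.pi, (∑ k ∈ Finset.range (C + 1),
        x ^ k / (Nat.factorial k : ℂ) * G k *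
          Complex.exp (((θ * ((n : ℝ) / N - k) : ℝ) : ℂ) * Complex.I)) ^ N =
      2 * Real.pi * (x ^ n / (Nat.factorial n : ℂ)) * ∑ f ∈ validPlacements n N C,
        ∏ j, G (Finset.univ.filter fun i => f i = j).card := by
  rw [integral_pow_eq C n N hN fun k => x ^ k / (Nat.factorial k : ℂ) * G k,
    mul_assoc (2 * (Real.pi : ℂ))]
  congr 1
  have hprod : ∀ k : Fin N → ℕ, (∏ j, if k j ≤ C then G (k j) else 0) =
      if ∀ j, k j ≤ C then ∏ j, G (k j) else 0 := by
    intro k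
    split_ifs with h
    · exact Finset.prod_congr rfl fun j _ => if_pos (h j)
    · push Not at h
      obtain ⟨j, hj⟩ := h
      exact Finset.prod_eq_zero (Finset.mem_univ j) (if_neg (by omega))
  have h := sum_prod_card_fiber n N (fun k => if k ≤ C then G k else 0)
  simp only [hprod] at h
  rw [validPlacements, Finset.sum_filter, Finset.sum_filter, h, Finset.mul_sum]
  refine Finset.sum_congr rfl fun k hk => ?_
  split_ifs
  · have hk' : ∑ j, k j = n := (Finset.mem_piAntidiag.1 hk).1
    have hm : (∏ j, ((k j).factorial : ℂ)) * (Nat.multinomial Finset.univ k : ℂ) =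
        (n.factorial : ℂ) := by
      have := Nat.multinomial_spec (s := Finset.univ) (f := k)
      rw [hk'] at this
      exact_mod_cast this
    rw [Finset.prod_mul_distrib, Finset.prod_div_distrib, Finset.prod_pow_eq_pow_sum, hk', ← hm]
    have h1 : (∏ j, ((k j).factorial : ℂ)) ≠ 0 :=
      Finset.prod_ne_zero_iff.2 fun j _ => by exact_mod_cast Nat.factorial_ne_zero _
    have h2 : (Nat.multinomial Finset.univ k : ℂ) ≠ 0 := by
      exact_mod_cast (Nat.multinomial_pos _ _).ne'
    field_simp
  · simp

theorem integral_pow_eq_sum_validPlacements_reflect (C n N : ℕ) (hN : 0 < N) (x g : ℝ)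
    (L : ℕ → ℝ) :
    ∫ θ in (-Real.pi)..Real.pi, (∑ j ∈ Finset.range (C + 1),
        ((x ^ (C - j) / (Nat.factorial (C - j) * g) : ℝ) : ℂ) *
          Complex.exp (((θ * (j - ((C : ℝ) - n / N)) + L j : ℝ) : ℂ) * Complex.I)) ^ N =
      ((2 * Real.pi * (x ^ n / (Nat.factorial n * g ^ N)) : ℝ) : ℂ) *
        ∑ f ∈ validPlacements n N C, Complex.exp
          (((∑ j, L (C - (Finset.univ.filter fun i => f i = j).card) : ℝ) : ℂ) * Complex.I) := by
  have h := integral_pow_eq_sum_validPlacements C n N hN x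
    (fun k => Complex.exp ((L (C - k) : ℂ) * Complex.I) / g)
  have h1 : ∀ θ : ℝ, ∑ k ∈ Finset.range (C + 1), (x : ℂ) ^ k / (Nat.factorial k : ℂ) *
      (Complex.exp ((L (C - k) : ℂ) * Complex.I) / g) *
        Complex.exp (((θ * ((n : ℝ) / N - k) : ℝ) : ℂ) * Complex.I) =
      ∑ j ∈ Finset.range (C + 1), ((x ^ (C - j) / (Nat.factorial (C - j) * g) : ℝ) : ℂ) *
          Complex.exp (((θ * (j - ((C : ℝ) - n / N)) + L j : ℝ) : ℂ) * Complex.I) := by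
    intro θ
    rw [← Finset.sum_range_reflect]
    refine Finset.sum_congr rfl fun j hj => ?_
    have hj' : j ≤ C := Nat.lt_succ_iff.1 (Finset.mem_range.1 hj)
    rw [show C + 1 - 1 - j = C - j by omega, Nat.sub_sub_self hj', mul_assoc, div_mul_eq_mul_div _ (g : ℂ),
      ← Complex.exp_add, Nat.cast_sub hj']
    have : (L j : ℂ) * Complex.I + ((θ * ((n : ℝ) / N - ((C : ℝ) - j)) : ℝ) : ℂ) * Complex.I =
        ((θ * (j - ((C : ℝ) - n / N)) + L j : ℝ) : ℂ) * Complex.I := by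
      push_cast; ring
    rw [this]
    push_cast
    ring
  simp_rw [h1] at h
  rw [h]
  have h2 : ∀ f : Fin n → Fin N, (∏ j, Complex.exp
      ((L (C - (Finset.univ.filter fun i => f i = j).card) : ℂ) * Complex.I) / g) =
      Complex.exp (((∑ j, L (C - (Finset.univ.filter fun i => f i = j).card) : ℝ) : ℂ)
        * Complex.I) * ((g : ℂ) ^ N)⁻¹ := by
    intro f
    rw [Finset.prod_div_distrib, ← Complex.exp_sum, ← Finset.sum_mul]
    simp [div_eq_mul_inv]
  simp_rw [h2]
  rw [← Finset.sum_mul]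
  push_cast
  rw [← div_div]
  ring

theorem norm_pow_sub_pow_le_mul {z w : ℂ} (hz : ‖z‖ ≤ 1) (hw : ‖w‖ ≤ 1) (k : ℕ) :
    ‖z ^ k - w ^ k‖ ≤ k * ‖z - w‖ := by
  induction k with
  | zero => simp
  | succ k ih =>
    have : z ^ (k + 1) - w ^ (k + 1) = z * (z ^ k - w ^ k) + (z - w) * w ^ k := by ring
    rw [this]
    have h1 : ‖w ^ k‖ ≤ 1 := by rw [norm_pow]; exact pow_le_one₀ (norm_nonneg _) hw
    calc _ ≤ ‖z‖ * ‖z ^ k - w ^ k‖ + ‖z - w‖ * ‖w ^ k‖ := by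
          refine (norm_add_le _ _).trans ?_
          rw [norm_mul, norm_mul]
      _ ≤ 1 * (k * ‖z - w‖) + ‖z - w‖ * 1 := by gcongr
      _ = _ := by push_cast; ring

theorem norm_exp_sub_quadratic_le {Y : ℝ} (hY : |Y| ≤ 1) :
    ‖Complex.exp ((Y : ℂ) * Complex.I) - 1 - (Y : ℂ) * Complex.I + (Y : ℂ) ^ 2 / 2‖ ≤ |Y| ^ 3 := by
  have hn : ‖(Y : ℂ) * Complex.I‖ = |Y| := by simp
  have h := Complex.exp_bound (x := (Y : ℂ) * Complex.I) (by rw [hn]; exact hY)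
    (n := 3) (by norm_num)
  rw [hn] at h
  have h1 : Complex.exp ((Y : ℂ) * Complex.I) - 1 - (Y : ℂ) * Complex.I + (Y : ℂ) ^ 2 / 2 =
      Complex.exp ((Y : ℂ) * Complex.I) -
        ∑ m ∈ Finset.range 3, ((Y : ℂ) * Complex.I) ^ m / (m.factorial : ℂ) := by
    simp [Finset.sum_range_succ, mul_pow, Complex.I_sq]
    ring
  rw [h1]
  refine h.trans ?_
  have : (0 : ℝ) ≤ |Y| ^ 3 := by positivity
  norm_num [Nat.factorial]
  linarith

theorem norm_sum_mul_exp_le {C : ℕ} (hC : 1 ≤ C) (p y : ℕ → ℝ) (hp : ∀ j, 0 ≤ p j)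
    (hsum : ∑ j ∈ Finset.range (C + 1), p j = 1) (hy : |y 1 - y 0| ≤ Real.pi) :
    ‖∑ j ∈ Finset.range (C + 1), (p j : ℂ) * Complex.exp ((y j : ℂ) * Complex.I)‖ ≤
      Real.exp (-(2 / Real.pi ^ 2 * (p 0 * p 1) * (y 1 - y 0) ^ 2)) := by
  obtain ⟨D, rfl⟩ : ∃ D, C = D + 1 := ⟨C - 1, by omega⟩
  rw [Finset.sum_range_succ', Finset.sum_range_succ'] at hsum ⊢
  set S := ∑ j ∈ Finset.range D, p (j + 1 + 1)
  have hS : 0 ≤ S := Finset.sum_nonneg fun _ _ => hp _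
  have hp0 := hp 0
  have hp1 := hp 1
  simp only [zero_add] at hsum ⊢
  have h1 : ‖∑ j ∈ Finset.range D, (p (j + 1 + 1) : ℂ) *
      Complex.exp ((y (j + 1 + 1) : ℂ) * Complex.I)‖ ≤ S := by
    refine (norm_sum_le _ _).trans (Finset.sum_le_sum fun j _ => ?_)
    rw [norm_mul, Complex.norm_exp_ofReal_mul_I, mul_one, Complex.norm_real, Real.norm_eq_abs,
      abs_of_nonneg (hp _)]
  set d := y 1 - y 0 with hd
  set c := 2 / Real.pi ^ 2 * (p 0 * p 1) * d ^ 2 with hc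
  have hcos : Real.cos d ≤ 1 - 2 / Real.pi ^ 2 * d ^ 2 := Real.cos_le_one_sub_mul_cos_sq hy
  have hc0 : 0 ≤ c := by positivity
  have hcle : c ≤ 2 * (p 0 * p 1) := by
    have : 2 / Real.pi ^ 2 * d ^ 2 ≤ 2 := by linarith [Real.neg_one_le_cos d]
    nlinarith [mul_nonneg hp0 hp1]
  have h2 : ‖(p 1 : ℂ) * Complex.exp ((y 1 : ℂ) * Complex.I) +
      (p 0 : ℂ) * Complex.exp ((y 0 : ℂ) * Complex.I)‖ ≤ p 0 + p 1 - c := by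
    have hsq : ‖(p 1 : ℂ) * Complex.exp ((y 1 : ℂ) * Complex.I) +
      (p 0 : ℂ) * Complex.exp ((y 0 : ℂ) * Complex.I)‖ ^ 2 =
        p 0 ^ 2 + p 1 ^ 2 + 2 * (p 0 * p 1) * Real.cos d := by
      rw [Complex.sq_norm, Complex.normSq_apply, hd, Real.cos_sub]
      simp [Complex.exp_ofReal_mul_I_re, Complex.exp_ofReal_mul_I_im]
      nlinarith [Real.sin_sq_add_cos_sq (y 0), Real.sin_sq_add_cos_sq (y 1)]
    refine le_of_sq_le_sq ?_ ?_
    · rw [hsq]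
      nlinarith [mul_nonneg hp0 hp1, mul_le_mul_of_nonneg_left hcos (mul_nonneg hp0 hp1)]
    · nlinarith
  rw [add_assoc]
  refine (norm_add_le _ _).trans ?_
  have hexp := Real.add_one_le_exp (-c)
  linarith [(add_le_add h1 h2)]

theorem tendsto_pow_exp_of_tendsto_mul_sub_one {N : ℕ → ℕ} (hN : Tendsto N atTop atTop)
    {z : ℕ → ℂ} (hz : ∀ ν, ‖z ν‖ ≤ 1) {R : ℝ} (hR : 0 ≤ R)
    (h : Tendsto (fun ν => (N ν : ℂ) * (z ν - 1)) atTop (nhds (-(R : ℂ)))) :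
    Tendsto (fun ν => z ν ^ N ν) atTop (nhds (Complex.exp (-(R : ℂ)))) := by
  have hw : Tendsto (fun ν => (N ν : ℂ) * (Complex.exp (-(R : ℂ) / N ν) - 1)) atTop
      (nhds (-(R : ℂ))) := by
    have h0 : Tendsto (fun ν => R ^ 2 / (N ν : ℝ)) atTop (nhds 0) :=
      tendsto_const_nhds.div_atTop (tendsto_natCast_atTop_atTop.comp hN)
    rw [tendsto_iff_norm_sub_tendsto_zero]
    refine squeeze_zero' (Eventually.of_forall fun _ => norm_nonneg _) ?_ h0
    filter_upwards [(tendsto_natCast_atTop_atTop (R := ℝ)).comp hN |>.eventually_ge_atTop (max R 1)]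
      with ν hν
    have hν' : max R 1 ≤ (N ν : ℝ) := hν
    have hpos : (0 : ℝ) < N ν := lt_of_lt_of_le one_pos ((le_max_right _ _).trans hν')
    have hne : (N ν : ℂ) ≠ 0 := by exact_mod_cast hpos.ne'
    have hn : ‖-(R : ℂ) / N ν‖ = R / N ν := by
      rw [norm_div, norm_neg, Complex.norm_real, Real.norm_eq_abs, abs_of_nonneg hR]
      simp
    have hle : ‖-(R : ℂ) / N ν‖ ≤ 1 := by
      rw [hn, div_le_one hpos]; exact (le_max_left _ _).trans hν'
    have e : (N ν : ℂ) * (Complex.exp (-(R : ℂ) / N ν) - 1) - -(R : ℂ) =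
        N ν * (Complex.exp (-(R : ℂ) / N ν) - 1 - -(R : ℂ) / N ν) := by
      field_simp
    rw [e, norm_mul]
    calc _ ≤ ‖(N ν : ℂ)‖ * ‖-(R : ℂ) / N ν‖ ^ 2 := by
          gcongr; exact Complex.norm_exp_sub_one_sub_id_le hle
      _ = R ^ 2 / N ν := by
          rw [hn, Complex.norm_natCast]; field_simp
  have hd : Tendsto (fun ν => (N ν : ℝ) * ‖z ν - Complex.exp (-(R : ℂ) / N ν)‖) atTop
      (nhds 0) := by
    have := (h.sub hw).norm
    rw [sub_self, norm_zero] at this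
    refine this.congr fun ν => ?_
    rw [← mul_sub, norm_mul, Complex.norm_natCast]
    congr 2
    ring
  have hlim : Tendsto (fun ν => z ν ^ N ν - Complex.exp (-(R : ℂ) / N ν) ^ N ν) atTop
      (nhds 0) := by
    refine squeeze_zero_norm (fun ν => norm_pow_sub_pow_le_mul (hz ν) ?_ _) hd
    rw [Complex.norm_exp]
    have : (-(R : ℂ) / N ν).re = -(R / N ν) := by
      rw [neg_div, Complex.neg_re]
      norm_cast
    rw [this, Real.exp_le_one_iff]
    have : 0 ≤ R / (N ν : ℝ) := by positivity
    linarith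
  have h2 : Tendsto (fun ν => Complex.exp (-(R : ℂ) / N ν) ^ N ν) atTop
      (nhds (Complex.exp (-(R : ℂ)))) := by
    refine tendsto_const_nhds.congr' ?_
    filter_upwards [hN.eventually_ge_atTop 1] with ν hν
    have hne : (N ν : ℂ) ≠ 0 := by exact_mod_cast (by omega : N ν ≠ 0)
    rw [← Complex.exp_nat_mul]
    congr 1
    field_simp
  simpa using hlim.add h2

theorem tendsto_mul_exp_sub_one_sub {a Y : ℕ → ℝ} {r : ℝ} (ha : ∀ ν, 0 ≤ a ν)
    (hY : Tendsto Y atTop (nhds 0))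
    (hr : Tendsto (fun ν => Real.sqrt (a ν) * Y ν) atTop (nhds r)) :
    Tendsto (fun ν => (a ν : ℂ) * (Complex.exp ((Y ν : ℂ) * Complex.I) - 1 - (Y ν : ℂ) * Complex.I))
      atTop (nhds (-((r ^ 2 / 2 : ℝ) : ℂ))) := by
  have h2 : Tendsto (fun ν => a ν * Y ν ^ 2) atTop (nhds (r ^ 2)) :=
    (hr.pow 2).congr fun ν => by rw [mul_pow, Real.sq_sqrt (ha ν)]
  have h3 : Tendsto (fun ν => a ν * Y ν ^ 2 * |Y ν|) atTop (nhds 0) := by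
    simpa using h2.mul hY.abs
  have h4 : Tendsto (fun ν => (a ν : ℂ) * (Complex.exp ((Y ν : ℂ) * Complex.I) - 1 -
      (Y ν : ℂ) * Complex.I + (Y ν : ℂ) ^ 2 / 2)) atTop (nhds 0) := by
    refine squeeze_zero_norm' ?_ h3
    have : ∀ᶠ ν in atTop, |Y ν| < 1 := by
      have := hY.abs
      rw [abs_zero] at this
      exact this.eventually (gt_mem_nhds one_pos)
    filter_upwards [this] with ν hν
    rw [norm_mul, Complex.norm_real, Real.norm_eq_abs, abs_of_nonneg (ha ν), mul_assoc]
    refine mul_le_mul_of_nonneg_left ((norm_exp_sub_quadratic_le hν.le).trans_eq ?_) (ha ν)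
    rw [← sq_abs]; ring
  have h5 : Tendsto (fun ν => ((a ν * Y ν ^ 2 / 2 : ℝ) : ℂ)) atTop
      (nhds ((r ^ 2 / 2 : ℝ) : ℂ)) :=
    (Complex.continuous_ofReal.tendsto _).comp (h2.div_const 2)
  have := h4.sub h5
  rw [zero_sub] at this
  refine this.congr fun ν => ?_
  push_cast
  ring

theorem tendsto_charFun_pow (C : ℕ) {N : ℕ → ℕ} (hN : Tendsto N atTop atTop)
    {p y : ℕ → ℕ → ℝ} {r : ℕ → ℝ} (hp : ∀ ν j, 0 ≤ p ν j)
    (hsum : ∀ ν, ∑ j ∈ Finset.range (C + 1), p ν j = 1)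
    (hp0 : ∀ j ≤ C, j ≠ 0 → Tendsto (fun ν => p ν j) atTop (nhds 0))
    (hy0 : ∀ ν, y ν 0 = 0) (hy : ∀ j ≤ C, Tendsto (fun ν => y ν j) atTop (nhds 0))
    (hr : ∀ j ≤ C, Tendsto (fun ν => Real.sqrt (N ν * p ν j) * y ν j) atTop (nhds (r j))) :
    Tendsto (fun ν => (∑ j ∈ Finset.range (C + 1), (p ν j : ℂ) * Complex.exp
        (((y ν j - ∑ i ∈ Finset.range (C + 1), p ν i * y ν i : ℝ) : ℂ) * Complex.I)) ^ N ν) atTop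
      (nhds (Complex.exp (-(((∑ j ∈ Finset.range (C + 1), r j ^ 2) / 2 : ℝ) : ℂ)))) := by
  set m : ℕ → ℝ := fun ν => ∑ i ∈ Finset.range (C + 1), p ν i * y ν i with hm
  have hp1 : ∀ ν, ∀ j ≤ C, p ν j ≤ 1 := fun ν j hj => by
    rw [← hsum ν]
    exact Finset.single_le_sum (f := p ν) (fun i _ => hp ν i) (Finset.mem_range.2 (by omega))
  have hm0 : Tendsto m atTop (nhds 0) := by
    rw [← Finset.sum_const_zero (s := Finset.range (C + 1))]
    refine tendsto_finsetSum _ fun j hj => ?_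
    rcases eq_or_ne j 0 with rfl | hj0
    · simp [hy0]
    · have hj' : j ≤ C := by have := Finset.mem_range.1 hj; omega
      simpa using (hp0 j hj' hj0).mul (hy j hj')
  have hsm : Tendsto (fun ν => Real.sqrt (N ν) * m ν) atTop (nhds 0) := by
    have : Tendsto (fun ν => ∑ j ∈ Finset.range (C + 1), Real.sqrt (p ν j) *
        (Real.sqrt (N ν * p ν j) * y ν j)) atTop (nhds 0) := by
      rw [← Finset.sum_const_zero (s := Finset.range (C + 1))]
      refine tendsto_finsetSum _ fun j hj => ?_
      rcases eq_or_ne j 0 with rfl | hj0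
      · simp [hy0]
      · have hj' : j ≤ C := by have := Finset.mem_range.1 hj; omega
        simpa using (hp0 j hj' hj0).sqrt.mul (hr j hj')
    refine this.congr fun ν => ?_
    rw [hm, Finset.mul_sum]
    refine Finset.sum_congr rfl fun j _ => ?_
    rw [Real.sqrt_mul (Nat.cast_nonneg _)]
    nth_rewrite 3 [← Real.mul_self_sqrt (hp ν j)]
    ring
  have hterm : ∀ j ≤ C, Tendsto (fun ν => Real.sqrt (N ν * p ν j) * (y ν j - m ν)) atTop
      (nhds (r j)) := by
    intro j hj
    have h1 : Tendsto (fun ν => Real.sqrt (N ν * p ν j) * m ν) atTop (nhds 0) := by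
      refine squeeze_zero_norm (fun ν => ?_) (by simpa using hsm.norm)
      rw [norm_mul, ← Real.norm_eq_abs, ← Real.norm_eq_abs]
      refine mul_le_mul_of_nonneg_right ?_ (norm_nonneg _)
      rw [Real.norm_of_nonneg (Real.sqrt_nonneg _), Real.norm_of_nonneg (Real.sqrt_nonneg _)]
      exact Real.sqrt_le_sqrt (mul_le_of_le_one_right (Nat.cast_nonneg _) (hp1 ν j hj))
    have := (hr j hj).sub h1
    rw [sub_zero] at this
    exact this.congr fun ν => by ring
  refine tendsto_pow_exp_of_tendsto_mul_sub_one hN (fun ν => ?_) (by positivity) ?_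
  · refine (norm_sum_le _ _).trans ((Finset.sum_le_sum fun j _ => ?_).trans_eq (hsum ν))
    rw [norm_mul, Complex.norm_exp_ofReal_mul_I, mul_one, Complex.norm_real, Real.norm_eq_abs,
      abs_of_nonneg (hp _ _)]
  have h := tendsto_finsetSum (Finset.range (C + 1)) fun j hj =>
    tendsto_mul_exp_sub_one_sub (a := fun ν => N ν * p ν j) (Y := fun ν => y ν j - m ν) (r := r j)
      (fun ν => mul_nonneg (Nat.cast_nonneg _) (hp ν j))
      (by simpa using (hy j (by have := Finset.mem_range.1 hj; omega)).sub hm0)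
      (hterm j (by have := Finset.mem_range.1 hj; omega))
  have e : ∑ j ∈ Finset.range (C + 1), -((r j ^ 2 / 2 : ℝ) : ℂ) =
      -(((∑ j ∈ Finset.range (C + 1), r j ^ 2) / 2 : ℝ) : ℂ) := by
    push_cast
    rw [Finset.sum_neg_distrib, Finset.sum_div]
  rw [e] at h
  refine h.congr fun ν => ?_
  have hs : ∑ j ∈ Finset.range (C + 1), (p ν j : ℂ) = 1 := by exact_mod_cast hsum ν
  have hc : ∑ j ∈ Finset.range (C + 1), (p ν j : ℂ) * ((y ν j - m ν : ℝ) : ℂ) = 0 := by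
    have : ∑ j ∈ Finset.range (C + 1), p ν j * (y ν j - m ν) = 0 := by
      simp only [mul_sub, Finset.sum_sub_distrib]
      rw [← Finset.sum_mul, hsum, one_mul, hm, sub_self]
    exact_mod_cast this
  calc _ = (N ν : ℂ) * (∑ j ∈ Finset.range (C + 1), (p ν j : ℂ) *
          Complex.exp (((y ν j - m ν : ℝ) : ℂ) * Complex.I) -
        ∑ j ∈ Finset.range (C + 1), (p ν j : ℂ) -
        (∑ j ∈ Finset.range (C + 1), (p ν j : ℂ) * ((y ν j - m ν : ℝ) : ℂ)) * Complex.I) := by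
        rw [Finset.sum_mul, ← Finset.sum_sub_distrib, ← Finset.sum_sub_distrib, Finset.mul_sum]
        refine Finset.sum_congr rfl fun j _ => ?_
        push_cast
        ring
    _ = _ := by rw [hs, hc, zero_mul, sub_zero]

theorem tendsto_integral_charFun_pow {C : ℕ} (hC : 1 ≤ C) {N : ℕ → ℕ}
    (hN : Tendsto N atTop atTop) {p ℓ : ℕ → ℕ → ℝ} {r : ℕ → ℝ} (hp : ∀ ν j, 0 ≤ p ν j)
    (hsum : ∀ ν, ∑ j ∈ Finset.range (C + 1), p ν j = 1)
    (hp0 : Tendsto (fun ν => p ν 0) atTop (nhds 1))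
    (hσ : Tendsto (fun ν => N ν * p ν 1) atTop atTop)
    (hratio : ∀ j ≤ C, 2 ≤ j → Tendsto (fun ν => p ν j / p ν 1) atTop (nhds 0))
    (hℓ0 : ∀ ν, ℓ ν 0 = 0) (hℓ1 : ∀ ν, ℓ ν 1 = 0)
    (hℓ : ∀ j ≤ C, Tendsto (fun ν => ℓ ν j) atTop (nhds 0))
    (hr : ∀ j ≤ C, Tendsto (fun ν => Real.sqrt (N ν * p ν j) * ℓ ν j) atTop (nhds (r j))) :
    Tendsto (fun ν => (Real.sqrt (N ν * p ν 1) : ℂ) * ∫ θ in (-Real.pi)..Real.pi,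
        (∑ j ∈ Finset.range (C + 1), (p ν j : ℂ) * Complex.exp
          (((θ * (j - ∑ i ∈ Finset.range (C + 1), p ν i * i) +
            (ℓ ν j - ∑ i ∈ Finset.range (C + 1), p ν i * ℓ ν i) : ℝ) : ℂ) * Complex.I)) ^ N ν) atTop
      (nhds ((Real.sqrt (2 * Real.pi) : ℂ) *
        Complex.exp (-(((∑ j ∈ Finset.range (C + 1), r j ^ 2) / 2 : ℝ) : ℂ)))) := by
  set σ : ℕ → ℝ := fun ν => Real.sqrt (N ν * p ν 1) with hσdef
  have hσtop : Tendsto σ atTop atTop := Real.tendsto_sqrt_atTop.comp hσ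
  have hr0 : r 0 = 0 := by
    have := hr 0 (Nat.zero_le _)
    simp only [hℓ0, mul_zero] at this
    exact tendsto_nhds_unique this tendsto_const_nhds
  have hr1 : r 1 = 0 := by
    have := hr 1 hC
    simp only [hℓ1, mul_zero] at this
    exact tendsto_nhds_unique this tendsto_const_nhds
  have hp0' : ∀ j ≤ C, j ≠ 0 → Tendsto (fun ν => p ν j) atTop (nhds 0) := by
    intro j hj hj0
    have h1 : Tendsto (fun ν => 1 - p ν 0) atTop (nhds 0) := by
      simpa using (tendsto_const_nhds (x := (1 : ℝ))).sub hp0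
    refine squeeze_zero (fun ν => hp ν j) (fun ν => ?_) h1
    have : ∑ i ∈ {0, j}, p ν i ≤ ∑ i ∈ Finset.range (C + 1), p ν i :=
      Finset.sum_le_sum_of_subset_of_nonneg (by
        intro i hi
        simp only [Finset.mem_insert, Finset.mem_singleton] at hi
        rw [Finset.mem_range]
        omega) fun i _ _ => hp ν i
    rw [Finset.sum_pair hj0.symm, hsum] at this
    linarith
  set Ψ : ℕ → ℝ → ℂ := fun ν θ => (∑ j ∈ Finset.range (C + 1), (p ν j : ℂ) * Complex.exp
          (((θ * (j - ∑ i ∈ Finset.range (C + 1), p ν i * i) +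
            (ℓ ν j - ∑ i ∈ Finset.range (C + 1), p ν i * ℓ ν i) : ℝ) : ℂ) * Complex.I)) ^ N ν
    with hΨ
  have hcont : ∀ ν, Continuous (Ψ ν) := fun ν => by
    simp only [hΨ]
    fun_prop
  have hbound : ∀ᶠ ν in atTop, ∀ u, |u / σ ν| ≤ Real.pi →
      ‖Ψ ν (u / σ ν)‖ ≤ Real.exp (-(1 / Real.pi ^ 2) * u ^ 2) := by
    filter_upwards [hp0.eventually (lt_mem_nhds (by norm_num : (1 / 2 : ℝ) < 1)),
      hσtop.eventually_gt_atTop 0] with ν h1 h2 u hu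
    have h3 := norm_sum_mul_exp_le hC (p ν) (fun j => u / σ ν *
      (j - ∑ i ∈ Finset.range (C + 1), p ν i * i) +
        (ℓ ν j - ∑ i ∈ Finset.range (C + 1), p ν i * ℓ ν i)) (hp ν) (hsum ν)
    have h4 : (u / σ ν * (((1 : ℕ) : ℝ) - ∑ i ∈ Finset.range (C + 1), p ν i * i) +
        (ℓ ν 1 - ∑ i ∈ Finset.range (C + 1), p ν i * ℓ ν i)) - (u / σ ν *
      (((0 : ℕ) : ℝ) - ∑ i ∈ Finset.range (C + 1), p ν i * i) +
        (ℓ ν 0 - ∑ i ∈ Finset.range (C + 1), p ν i * ℓ ν i)) = u / σ ν := by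
      rw [hℓ0, hℓ1]; push_cast; ring
    simp only [h4] at h3
    have h5 := pow_le_pow_left₀ (norm_nonneg _) (h3 hu) (N ν)
    rw [← norm_pow] at h5
    refine h5.trans ?_
    rw [← Real.exp_nat_mul, Real.exp_le_exp]
    have h6 : σ ν ^ 2 = N ν * p ν 1 := Real.sq_sqrt (mul_nonneg (Nat.cast_nonneg _) (hp _ _))
    have h7 : (N ν : ℝ) * -(2 / Real.pi ^ 2 * (p ν 0 * p ν 1) * (u / σ ν) ^ 2) =
        -(2 * p ν 0 * (1 / Real.pi ^ 2 * u ^ 2)) := by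
      have : p ν 1 * N ν * (u / σ ν) ^ 2 = u ^ 2 := by
        rw [mul_comm (p ν 1), ← h6, div_pow]
        field_simp
      calc _ = -(2 * p ν 0 * (1 / Real.pi ^ 2 * (p ν 1 * N ν * (u / σ ν) ^ 2))) := by ring
        _ = _ := by rw [this]
    rw [h7]
    have : 0 ≤ 1 / Real.pi ^ 2 * u ^ 2 := by positivity
    nlinarith
  have hpoint : ∀ u : ℝ, Tendsto (fun ν => Ψ ν (u / σ ν)) atTop
      (nhds (Complex.exp (-(((u ^ 2 + ∑ j ∈ Finset.range (C + 1), r j ^ 2) / 2 : ℝ) : ℂ)))) := by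
    intro u
    have h := tendsto_charFun_pow C hN (p := p) (y := fun ν j => u / σ ν * j + ℓ ν j)
      (r := fun j => if j = 1 then u else r j) hp hsum hp0' (fun ν => by simp [hℓ0]) ?_ ?_
    · have e : ∑ j ∈ Finset.range (C + 1), (if j = 1 then u else r j) ^ 2 =
          u ^ 2 + ∑ j ∈ Finset.range (C + 1), r j ^ 2 := by
        have h1 : (1 : ℕ) ∈ Finset.range (C + 1) := Finset.mem_range.2 (by omega)
        rw [← Finset.add_sum_erase _ _ h1, ← Finset.add_sum_erase _ (fun j => r j ^ 2) h1]
        simp only [if_true, hr1]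
        rw [Finset.sum_congr rfl fun j hj => by rw [if_neg (Finset.ne_of_mem_erase hj)]]
        ring
      rw [e] at h
      refine h.congr fun ν => ?_
      simp only [hΨ]
      congr 1
      refine Finset.sum_congr rfl fun j _ => ?_
      congr 4
      have : ∑ i ∈ Finset.range (C + 1), p ν i * (u / σ ν * i + ℓ ν i) =
          u / σ ν * ∑ i ∈ Finset.range (C + 1), p ν i * i +
            ∑ i ∈ Finset.range (C + 1), p ν i * ℓ ν i := by
        rw [Finset.mul_sum, ← Finset.sum_add_distrib]
        exact Finset.sum_congr rfl fun i _ => by ring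
      rw [this]
      ring
    · intro j hj
      have : Tendsto (fun ν => u / σ ν) atTop (nhds 0) := tendsto_const_nhds.div_atTop hσtop
      simpa using (this.mul_const (j : ℝ)).add (hℓ j hj)
    · intro j hj
      have key : Tendsto (fun ν => Real.sqrt (N ν * p ν j) * (u / σ ν * j)) atTop
          (nhds (if j = 1 then u else 0)) := by
        split_ifs with hj1
        · subst hj1
          refine tendsto_const_nhds.congr' ?_
          filter_upwards [hσtop.eventually_gt_atTop 0] with ν hν
          change u = σ ν * _
          push_cast
          field_simp
        · rcases eq_or_ne j 0 with rfl | hj0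
          · simp
          · have h1 := (hratio j hj (by omega)).sqrt.mul_const (u * j)
            rw [Real.sqrt_zero, zero_mul] at h1
            refine h1.congr' ?_
            filter_upwards [hN.eventually_gt_atTop 0] with ν hν
            have hν' : (0 : ℝ) < N ν := by exact_mod_cast hν
            rw [← mul_div_mul_left (p ν j) (p ν 1) hν'.ne',
              Real.sqrt_div (mul_nonneg hν'.le (hp _ _))]
            change _ / σ ν * _ = _
            ring
      have h2 := key.add (hr j hj)
      have e : (if j = 1 then u else 0) + r j = if j = 1 then u else r j := by
        split_ifs with h
        · rw [h, hr1, add_zero]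
        · rw [zero_add]
      rw [e] at h2
      exact h2.congr fun ν => by ring
  have hmain : Tendsto (fun ν => ∫ u, (Set.Ioc (-Real.pi * σ ν) (Real.pi * σ ν)).indicator
      (fun u => Ψ ν (u / σ ν)) u) atTop (nhds (∫ u : ℝ,
        Complex.exp (-(((u ^ 2 + ∑ j ∈ Finset.range (C + 1), r j ^ 2) / 2 : ℝ) : ℂ)))) := by
    refine tendsto_integral_filter_of_dominated_convergence
      (fun u => Real.exp (-(1 / Real.pi ^ 2) * u ^ 2)) ?_ ?_ ?_ ?_
    · refine Eventually.of_forall fun ν => ?_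
      refine AEStronglyMeasurable.indicator ?_ measurableSet_Ioc
      exact ((hcont ν).comp (continuous_id.div_const _)).aestronglyMeasurable
    · filter_upwards [hbound, hσtop.eventually_gt_atTop 0] with ν hν hpos
      refine Eventually.of_forall fun u => ?_
      by_cases hu : u ∈ Set.Ioc (-Real.pi * σ ν) (Real.pi * σ ν)
      · rw [Set.indicator_of_mem hu]
        refine hν u ?_
        rw [Set.mem_Ioc] at hu
        rw [abs_le, le_div_iff₀ hpos, div_le_iff₀ hpos]
        exact ⟨hu.1.le, hu.2⟩
      · rw [Set.indicator_of_notMem hu, norm_zero]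
        positivity
    · exact integrable_exp_neg_mul_sq (by positivity)
    · refine Eventually.of_forall fun u => ?_
      refine (hpoint u).congr' ?_
      filter_upwards [hσtop.eventually_gt_atTop (|u| / Real.pi), hσtop.eventually_gt_atTop 0]
        with ν hν hpos
      rw [Set.indicator_of_mem]
      rw [Set.mem_Ioc]
      rw [div_lt_iff₀ Real.pi_pos] at hν
      have := abs_lt.1 hν
      constructor <;> linarith
  have hgauss : ∫ u : ℝ, Complex.exp
      (-(((u ^ 2 + ∑ j ∈ Finset.range (C + 1), r j ^ 2) / 2 : ℝ) : ℂ)) =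
      (Real.sqrt (2 * Real.pi) : ℂ) *
        Complex.exp (-(((∑ j ∈ Finset.range (C + 1), r j ^ 2) / 2 : ℝ) : ℂ)) := by
    have h1 := integral_gaussian (1 / 2)
    have h2 : Real.pi / (1 / 2) = 2 * Real.pi := by ring
    rw [h2] at h1
    rw [← h1, ← integral_complex_ofReal, ← integral_mul_const]
    refine integral_congr_ae (Eventually.of_forall fun u => ?_)
    simp only
    rw [Complex.ofReal_exp, ← Complex.exp_add]
    congr 1
    push_cast
    ring
  rw [hgauss] at hmain
  refine hmain.congr' ?_
  filter_upwards [hσtop.eventually_gt_atTop 0] with ν hpos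
  rw [integral_indicator measurableSet_Ioc, ← intervalIntegral.integral_of_le]
  · rw [intervalIntegral.integral_comp_div (Ψ ν) hpos.ne', mul_div_cancel_right₀ _ hpos.ne',
      mul_div_cancel_right₀ _ hpos.ne', Complex.real_smul]
  · nlinarith [Real.pi_pos]

/-- The probability that a `Poisson(x)` variable conditioned to be at most `C` equals `C - j`. -/
noncomputable def holeProb (C : ℕ) (x : ℝ) (j : ℕ) : ℝ :=
  x ^ (C - j) / (Nat.factorial (C - j) * gfun C x)

theorem gfun_pos (C : ℕ) {x : ℝ} (hx : 0 < x) : 0 < gfun C x :=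
  Finset.sum_pos (fun _ _ => by positivity) ⟨0, by simp⟩

theorem mul_deriv_gfun (C : ℕ) (x : ℝ) :
    x * deriv (gfun C) x = ∑ k ∈ Finset.range (C + 1), k * (x ^ k / (Nat.factorial k)) := by
  have h : HasDerivAt (gfun C)
      (∑ k ∈ Finset.range (C + 1), (k * x ^ (k - 1)) / (Nat.factorial k : ℝ)) x :=
    HasDerivAt.fun_sum fun k _ => (hasDerivAt_pow k x).div_const _
  rw [h.deriv, Finset.mul_sum]
  refine Finset.sum_congr rfl fun k _ => ?_
  rcases k with _ | k
  · simp
  · rw [Nat.add_sub_cancel, pow_succ]; ring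

theorem holeProb_nonneg (C : ℕ) {x : ℝ} (hx : 0 < x) (j : ℕ) : 0 ≤ holeProb C x j := by
  have := gfun_pos C hx
  unfold holeProb
  positivity

theorem sum_holeProb (C : ℕ) {x : ℝ} (hx : 0 < x) :
    ∑ j ∈ Finset.range (C + 1), holeProb C x j = 1 := by
  have hg := gfun_pos C hx
  have h := Finset.sum_range_reflect
    (fun k => x ^ k / ((Nat.factorial k : ℝ) * gfun C x)) (C + 1)
  simp only [Nat.add_sub_cancel] at h
  simp only [holeProb]
  rw [h]
  simp only [← div_div]
  rw [← Finset.sum_div]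
  exact div_self hg.ne'

theorem sum_holeProb_mul (C : ℕ) {x : ℝ} (hx : 0 < x) :
    ∑ j ∈ Finset.range (C + 1), holeProb C x j * j = C - x * deriv (gfun C) x / gfun C x := by
  have h1 : ∑ j ∈ Finset.range (C + 1), holeProb C x j * ((C - j : ℕ) : ℝ) =
      x * deriv (gfun C) x / gfun C x := by
    rw [mul_deriv_gfun, Finset.sum_div]
    have h := Finset.sum_range_reflect
      (fun k => (k : ℝ) * (x ^ k / (Nat.factorial k : ℝ)) / gfun C x) (C + 1)
    rw [← h]
    refine Finset.sum_congr rfl fun j _ => ?_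
    rw [Nat.add_sub_cancel, holeProb, ← div_div]
    ring
  rw [← h1, eq_sub_iff_add_eq, ← Finset.sum_add_distrib]
  calc _ = ∑ j ∈ Finset.range (C + 1), holeProb C x j * C := by
        refine Finset.sum_congr rfl fun j hj => ?_
        have : j ≤ C := Nat.lt_succ_iff.1 (Finset.mem_range.1 hj)
        rw [Nat.cast_sub this]; ring
    _ = _ := by rw [← Finset.sum_mul, sum_holeProb C hx, one_mul]

theorem holeProb_eq {C j : ℕ} (hj : j ≤ C) {x : ℝ} (hx : 0 < x) :
    holeProb C x j = holeProb C x 0 * C.descFactorial j * x⁻¹ ^ j := by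
  have hg := gfun_pos C hx
  have h1 : ((C - j).factorial : ℝ) * C.descFactorial j = C.factorial := by
    exact_mod_cast Nat.factorial_mul_descFactorial hj
  have h2 : x ^ C = x ^ (C - j) * x ^ j := by rw [← pow_add, Nat.sub_add_cancel hj]
  have h3 : (C.descFactorial j : ℝ) ≠ 0 := by
    exact_mod_cast (Nat.descFactorial_pos.2 hj).ne'
  unfold holeProb
  rw [Nat.sub_zero, ← h1, h2, inv_pow]
  field_simp

theorem validPlacements_nonempty {n N C : ℕ} (h : n ≤ C * N) : (validPlacements n N C).Nonempty := by
  have hlt : ∀ i : Fin n, (i : ℕ) / C < N := fun i =>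
    Nat.div_lt_of_lt_mul (lt_of_lt_of_le i.2 h)
  refine ⟨fun i => ⟨i / C, hlt i⟩, ?_⟩
  rw [validPlacements, Finset.mem_filter]
  refine ⟨Finset.mem_univ _, fun j => ?_⟩
  have hC : ∀ i : Fin n, 0 < C := fun i => by
    rcases Nat.eq_zero_or_pos C with rfl | h0
    · have := i.2; omega
    · exact h0
  have : ((Finset.univ.filter fun i : Fin n => (⟨i / C, hlt i⟩ : Fin N) = j).map
      Fin.valEmbedding) ⊆ Finset.Ico (C * j) (C * j + C) := by
    intro k hk
    simp only [Finset.mem_map, Finset.mem_filter, Finset.mem_univ, true_and] at hk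
    obtain ⟨i, rfl, rfl⟩ := hk
    rw [Finset.mem_Ico]
    exact ⟨Nat.mul_div_le _ _, Nat.lt_mul_div_succ _ (hC i)⟩
  have h2 := Finset.card_le_card this
  simpa using h2

/-- The function of the number of holes in a bin whose sum over all bins equals
`α X_{C-1} + β X_{C-2}` up to a multiple of the total number of holes. -/
def holeWeight (α β : ℝ) (k : ℕ) : ℝ :=
  (if k = 1 then α else 0) + (if k = 2 then β else 0) - α * k

theorem sum_holeWeight_sub {C n N : ℕ} (hC : 3 ≤ C) (α β M : ℝ) {f : Fin n → Fin N}
    (hf : f ∈ validPlacements n N C) :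
    ∑ j, (holeWeight α β (C - (Finset.univ.filter fun i => f i = j).card) - M) =
      α * binCount f (C - 1) + β * binCount f (C - 2) - α * (C * N - n) - N * M := by
  have hle : ∀ j, (Finset.univ.filter fun i => f i = j).card ≤ C := by
    rw [validPlacements, Finset.mem_filter] at hf
    exact hf.2
  have hcount : ∑ j, (Finset.univ.filter fun i => f i = j).card = n := by
    have := Finset.card_eq_sum_card_fiberwise (f := f) (s := Finset.univ) (t := Finset.univ)
      (by simp)
    simpa using this.symm
  have hcount' : ∑ j, ((Finset.univ.filter fun i => f i = j).card : ℝ) = n := by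
    exact_mod_cast hcount
  have hb : ∀ m : ℕ, ∀ γ : ℝ, γ * binCount f m =
      ∑ j, if (Finset.univ.filter fun i => f i = j).card = m then γ else 0 := by
    intro m γ
    rw [← Finset.sum_filter, Finset.sum_const, nsmul_eq_mul, mul_comm]
    rfl
  have hterm : ∀ j, holeWeight α β (C - (Finset.univ.filter fun i => f i = j).card) - M =
      (if (Finset.univ.filter fun i => f i = j).card = C - 1 then α else 0) +
      (if (Finset.univ.filter fun i => f i = j).card = C - 2 then β else 0) -
        α * (C - ((Finset.univ.filter fun i => f i = j).card : ℝ)) - M := by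
    intro j
    have h := hle j
    rw [holeWeight, Nat.cast_sub h]
    have e1 : C - (Finset.univ.filter fun i => f i = j).card = 1 ↔
      (Finset.univ.filter fun i => f i = j).card = C - 1 := by omega
    have e2 : C - (Finset.univ.filter fun i => f i = j).card = 2 ↔
      (Finset.univ.filter fun i => f i = j).card = C - 2 := by omega
    simp only [e1, e2]
  rw [Finset.sum_congr rfl fun j _ => hterm j, Finset.sum_sub_distrib, Finset.sum_sub_distrib,
    Finset.sum_add_distrib, ← hb, ← hb, ← Finset.mul_sum, Finset.sum_sub_distrib, hcount']
  simp only [Finset.sum_const, Finset.card_univ, Fintype.card_fin, nsmul_eq_mul]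
  ring

theorem sum_mul_holeWeight {C : ℕ} (hC : 3 ≤ C) (α β : ℝ) (p : ℕ → ℝ) :
    ∑ j ∈ Finset.range (C + 1), p j * holeWeight α β j =
      α * p 1 + β * p 2 - α * ∑ j ∈ Finset.range (C + 1), p j * j := by
  have h1 : (1 : ℕ) ∈ Finset.range (C + 1) := Finset.mem_range.2 (by omega)
  have h2 : (2 : ℕ) ∈ Finset.range (C + 1) := Finset.mem_range.2 (by omega)
  simp only [holeWeight, mul_sub, mul_add, mul_ite, mul_zero, Finset.sum_sub_distrib,
    Finset.sum_add_distrib, Finset.sum_ite_eq', h1, h2, if_true]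
  rw [Finset.mul_sum, mul_comm α, mul_comm β]
  congr 1
  exact Finset.sum_congr rfl fun j _ => by ring

theorem one_sub_holeProb_zero_le (C : ℕ) {x : ℝ} (hx : 0 < x) :
    1 - holeProb C x 0 ≤ ∑ j ∈ Finset.range (C + 1), holeProb C x j * j := by
  rw [← sum_holeProb C hx, Finset.sum_range_succ', Finset.sum_range_succ', add_sub_cancel_right]
  simp only [Nat.cast_zero, mul_zero, add_zero]
  refine Finset.sum_le_sum fun j _ => ?_
  exact le_mul_of_one_le_right (holeProb_nonneg C hx _) (by push_cast; linarith [j.cast_nonneg (α := ℝ)])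

theorem holeProb_zero_le_one (C : ℕ) {x : ℝ} (hx : 0 < x) : holeProb C x 0 ≤ 1 := by
  rw [← sum_holeProb C hx]
  exact Finset.single_le_sum (f := holeProb C x) (fun j _ => holeProb_nonneg C hx j) (by simp)

theorem tendsto_holeProb_zero {C : ℕ} {x : ℕ → ℝ} (hx : ∀ ν, 0 < x ν)
    (hm : Tendsto (fun ν => ∑ j ∈ Finset.range (C + 1), holeProb C (x ν) j * j) atTop (nhds 0)) :
    Tendsto (fun ν => holeProb C (x ν) 0) atTop (nhds 1) := by
  have h1 : Tendsto (fun ν => 1 - ∑ j ∈ Finset.range (C + 1), holeProb C (x ν) j * j) atTop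
      (nhds 1) := by simpa using tendsto_const_nhds.sub hm
  refine tendsto_of_tendsto_of_tendsto_of_le_of_le h1 tendsto_const_nhds (fun ν => ?_)
    fun ν => holeProb_zero_le_one C (hx ν)
  have := one_sub_holeProb_zero_le C (hx ν)
  simp only
  linarith

theorem tendsto_inv_of_tendsto_sum_holeProb {C : ℕ} (hC : 1 ≤ C) {x : ℕ → ℝ} (hx : ∀ ν, 0 < x ν)
    (hm : Tendsto (fun ν => ∑ j ∈ Finset.range (C + 1), holeProb C (x ν) j * j) atTop (nhds 0)) :
    Tendsto (fun ν => (x ν)⁻¹) atTop (nhds 0) := by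
  have h0 := tendsto_holeProb_zero hx hm
  have h1 : Tendsto (fun ν => holeProb C (x ν) 1) atTop (nhds 0) := by
    refine squeeze_zero (fun ν => holeProb_nonneg C (hx ν) 1) (fun ν => ?_) hm
    have := Finset.single_le_sum (f := fun j => holeProb C (x ν) j * (j : ℝ))
      (s := Finset.range (C + 1)) (a := 1)
      (fun j _ => mul_nonneg (holeProb_nonneg C (hx ν) j) j.cast_nonneg)
      (Finset.mem_range.2 (by omega))
    simpa using this
  have h2 : Tendsto (fun ν => holeProb C (x ν) 1 / (holeProb C (x ν) 0 * C)) atTop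
      (nhds (0 / (1 * C))) :=
    h1.div (h0.mul_const _) (by positivity)
  rw [zero_div] at h2
  refine h2.congr fun ν => ?_
  have : 0 < holeProb C (x ν) 0 := by
    have := gfun_pos C (hx ν)
    have := hx ν
    unfold holeProb
    positivity
  have hC' : (C : ℝ) ≠ 0 := by positivity
  rw [holeProb_eq hC (hx ν)]
  simp only [Nat.descFactorial_one, pow_one]
  field_simp

theorem holeProb_zero_pos (C : ℕ) {x : ℝ} (hx : 0 < x) : 0 < holeProb C x 0 := by
  have := gfun_pos C hx
  unfold holeProb
  positivity

theorem tendsto_pow_div_of_tendsto_div_rpow {x : ℕ → ℝ} {N : ℕ → ℕ} (hx : ∀ ν, 0 < x ν)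
    (hinv : Tendsto (fun ν => (x ν)⁻¹) atTop (nhds 0))
    (hxN : Tendsto (fun ν => x ν / (N ν : ℝ) ^ ((1 : ℝ) / 7)) atTop (nhds 0)) {k : ℕ} (hk : k ≤ 7) :
    Tendsto (fun ν => x ν ^ k / N ν) atTop (nhds 0) := by
  have h7 : Tendsto (fun ν => x ν ^ 7 / N ν) atTop (nhds 0) := by
    have := hxN.pow 7
    rw [zero_pow (by norm_num)] at this
    refine this.congr fun ν => ?_
    rw [div_pow, ← Real.rpow_natCast ((N ν : ℝ) ^ ((1 : ℝ) / 7)), ← Real.rpow_mul (by positivity)]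
    norm_num
  have h := (hinv.pow (7 - k)).mul h7
  rcases eq_or_lt_of_le hk with rfl | hlt
  · exact h7
  rw [mul_zero] at h
  refine h.congr fun ν => ?_
  have h2 : x ν ^ 7 = x ν ^ (7 - k) * x ν ^ k := by rw [← pow_add, Nat.sub_add_cancel hk]
  have := (hx ν).ne'
  rw [h2, inv_pow]
  field_simp

/-- Characteristic function asymptotics for linear statistics of the bin counts. -/
theorem tendsto_average_exp_binCount {C : ℕ} (hC : 3 ≤ C) {n N : ℕ → ℕ} (hNpos : ∀ ν, 0 < N ν)
    (hN : Tendsto N atTop atTop) {x : ℕ → ℝ} (hx : ∀ ν, 0 < x ν)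
    (hmean : ∀ ν, ∑ j ∈ Finset.range (C + 1), holeProb C (x ν) j * j = C - (n ν : ℝ) / N ν)
    (hgap : Tendsto (fun ν => C - (n ν : ℝ) / N ν) atTop (nhds 0))
    (hinv : Tendsto (fun ν => x ν / N ν) atTop (nhds 0))
    {α β : ℕ → ℝ} {r : ℕ → ℝ}
    (hℓ : ∀ j ≤ C, Tendsto (fun ν => holeWeight (α ν) (β ν) j) atTop (nhds 0))
    (hr : ∀ j ≤ C, Tendsto (fun ν => √(N ν * holeProb C (x ν) j) * holeWeight (α ν) (β ν) j)
      atTop (nhds (r j))) :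
    Tendsto (fun ν => (∑ f ∈ validPlacements (n ν) (N ν) C,
        Complex.exp (((α ν * (binCount f (C - 1) - N ν * holeProb C (x ν) 1) +
          β ν * (binCount f (C - 2) - N ν * holeProb C (x ν) 2) : ℝ) : ℂ) * Complex.I)) /
        ((validPlacements (n ν) (N ν) C).card : ℂ)) atTop
      (nhds (Complex.exp (-(((∑ j ∈ Finset.range (C + 1), r j ^ 2) / 2 : ℝ) : ℂ)))) := by
  have hm : Tendsto (fun ν => ∑ j ∈ Finset.range (C + 1), holeProb C (x ν) j * j) atTop
      (nhds 0) := hgap.congr fun ν => (hmean ν).symm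
  have hxinv := tendsto_inv_of_tendsto_sum_holeProb (by omega) hx hm
  have hp0 := tendsto_holeProb_zero hx hm
  have hNr : ∀ ν, (0 : ℝ) < N ν := fun ν => Nat.cast_pos.2 (hNpos ν)
  have hCr : (0 : ℝ) < C := by positivity
  have hq1 : ∀ ν, holeProb C (x ν) 1 = holeProb C (x ν) 0 * C * (x ν)⁻¹ := fun ν => by
    rw [holeProb_eq (by omega) (hx ν), Nat.descFactorial_one, pow_one]
  have hq1pos : ∀ ν, 0 < holeProb C (x ν) 1 := fun ν => by
    rw [hq1]
    have := hx ν
    have := holeProb_zero_pos C (hx ν)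
    positivity
  have hσ : Tendsto (fun ν => N ν * holeProb C (x ν) 1) atTop atTop := by
    have h1 : Tendsto (fun ν => (x ν / N ν)⁻¹) atTop atTop := by
      refine Tendsto.inv_tendsto_nhdsGT_zero ?_
      exact tendsto_nhdsWithin_iff.2 ⟨hinv, Eventually.of_forall fun ν => div_pos (hx ν) (hNr ν)⟩
    have h2 := (hp0.mul_const (C : ℝ)).pos_mul_atTop (by positivity) h1
    refine h2.congr fun ν => ?_
    rw [hq1, inv_div]
    ring
  have hratio : ∀ j ≤ C, 2 ≤ j →
      Tendsto (fun ν => holeProb C (x ν) j / holeProb C (x ν) 1) atTop (nhds 0) := by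
    intro j hj h2
    have h := (hxinv.pow (j - 1)).const_mul ((C.descFactorial j : ℝ) / C)
    rw [zero_pow (by omega), mul_zero] at h
    refine h.congr fun ν => ?_
    have h0 := holeProb_zero_pos C (hx ν)
    have hxν := hx ν
    rw [hq1, holeProb_eq hj (hx ν)]
    obtain ⟨i, rfl⟩ := Nat.exists_eq_add_of_le' (show 1 ≤ j by omega)
    rw [Nat.add_sub_cancel, pow_succ]
    field_simp
  have hJ := tendsto_integral_charFun_pow (by omega) hN
    (fun ν j => holeProb_nonneg C (hx ν) j) (fun ν => sum_holeProb C (hx ν)) hp0 hσ hratio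
    (ℓ := fun ν j => holeWeight (α ν) (β ν) j) (r := r)
    (fun ν => by simp [holeWeight]) (fun ν => by simp [holeWeight]) hℓ hr
  have hJ0 := tendsto_integral_charFun_pow (by omega) hN
    (fun ν j => holeProb_nonneg C (hx ν) j) (fun ν => sum_holeProb C (hx ν)) hp0 hσ hratio
    (ℓ := fun _ _ => 0) (r := fun _ => 0) (by simp) (by simp) (by simp) (by simp)
  have hπ : ((√(2 * Real.pi) : ℝ) : ℂ) ≠ 0 := by
    exact_mod_cast (Real.sqrt_pos.2 (by positivity : (0 : ℝ) < 2 * Real.pi)).ne'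
  have hdiv := hJ.div hJ0 (mul_ne_zero hπ (Complex.exp_ne_zero _))
  have hlim : ((√(2 * Real.pi) : ℝ) : ℂ) *
        Complex.exp (-(((∑ j ∈ Finset.range (C + 1), r j ^ 2) / 2 : ℝ) : ℂ)) /
      (((√(2 * Real.pi) : ℝ) : ℂ) *
        Complex.exp (-(((∑ j ∈ Finset.range (C + 1), (0 : ℝ) ^ 2) / 2 : ℝ) : ℂ))) =
      Complex.exp (-(((∑ j ∈ Finset.range (C + 1), r j ^ 2) / 2 : ℝ) : ℂ)) := by
    simp only [zero_pow two_ne_zero, Finset.sum_const_zero, zero_div, Complex.ofReal_zero,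
      neg_zero, Complex.exp_zero, mul_one]
    field_simp
  rw [hlim] at hdiv
  refine hdiv.congr fun ν => ?_
  set M : ℝ := ∑ i ∈ Finset.range (C + 1), holeProb C (x ν) i * holeWeight (α ν) (β ν) i with hM
  have hs : ((√(N ν * holeProb C (x ν) 1) : ℝ) : ℂ) ≠ 0 := by
    exact_mod_cast (Real.sqrt_pos.2 (mul_pos (hNr ν) (hq1pos ν))).ne'
  have hg := gfun_pos C (hx ν)
  have hxν := hx ν
  have hc : ((2 * Real.pi * (x ν ^ n ν / ((n ν).factorial * gfun C (x ν) ^ N ν)) : ℝ) : ℂ) ≠ 0 := by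
    have : (0 : ℝ) < 2 * Real.pi * (x ν ^ n ν / ((n ν).factorial * gfun C (x ν) ^ N ν)) := by
      positivity
    exact_mod_cast this.ne'
  have e1 := integral_pow_eq_sum_validPlacements_reflect C (n ν) (N ν) (hNpos ν) (x ν)
    (gfun C (x ν)) (fun j => holeWeight (α ν) (β ν) j - M)
  have e0 := integral_pow_eq_sum_validPlacements_reflect C (n ν) (N ν) (hNpos ν) (x ν)
    (gfun C (x ν)) (fun j => 0 - 0)
  simp only [← hmean, ← holeProb.eq_1 C] at e1 e0
  simp only [mul_zero, Finset.sum_const_zero, Pi.div_apply]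
  rw [e1, e0, mul_div_mul_left _ _ hs, mul_div_mul_left _ _ hc]
  congr 1
  · refine Finset.sum_congr rfl fun f hf => ?_
    rw [sum_holeWeight_sub hC _ _ _ hf, hM, sum_mul_holeWeight hC, hmean]
    congr 3
    have := (hNr ν).ne'
    field_simp
    ring
  · simp

theorem rpow_three_halves_div {x K N : ℝ} (hx : 0 < x) :
    x ^ ((3 : ℝ) / 2) / (3 * √(5 * K * N)) = √(x ^ 3 / (45 * K * N)) := by
  rw [Real.sqrt_div (pow_nonneg hx.le 3), Real.sqrt_eq_rpow (x ^ 3), ← Real.rpow_natCast x 3,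
    ← Real.rpow_mul hx.le, show (45 : ℝ) * K * N = 3 ^ 2 * (5 * K * N) by ring,
    Real.sqrt_mul (by norm_num : (0 : ℝ) ≤ 3 ^ 2) (5 * K * N),
    Real.sqrt_sq (by norm_num)]
  norm_num

/-- The limits of the standardized hole weights. -/
noncomputable def limitWeight (a b : ℝ) (j : ℕ) : ℝ :=
  if j = 2 then √(1 / 45) * (3 * (b - 2 * a)) else
    if j = 3 then √(1 / 45) * (-3 * (a + 2 * b)) else 0

theorem sum_limitWeight_sq {C : ℕ} (hC : 3 ≤ C) (a b : ℝ) :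
    ∑ j ∈ Finset.range (C + 1), limitWeight a b j ^ 2 = a ^ 2 + b ^ 2 := by
  have hs : ({2, 3} : Finset ℕ) ⊆ Finset.range (C + 1) := by
    intro j hj
    simp only [Finset.mem_insert, Finset.mem_singleton] at hj
    exact Finset.mem_range.2 (by omega)
  rw [← Finset.sum_subset hs fun j _ hj => by
    simp only [Finset.mem_insert, Finset.mem_singleton, not_or] at hj
    simp [limitWeight, hj.1, hj.2], Finset.sum_pair (by norm_num)]
  simp only [limitWeight, if_true, show (3 : ℕ) ≠ 2 by norm_num, if_false, mul_pow,
    Real.sq_sqrt (show (0 : ℝ) ≤ 1 / 45 by norm_num)]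
  ring

theorem tendsto_sqrt_mul_holeWeight {C : ℕ} (hC : 3 ≤ C) {N : ℕ → ℕ} (hNpos : ∀ ν, 0 < N ν)
    {x : ℕ → ℝ} (hx : ∀ ν, 0 < x ν)
    (hp0 : Tendsto (fun ν => holeProb C (x ν) 0) atTop (nhds 1))
    (hinv : Tendsto (fun ν => (x ν)⁻¹) atTop (nhds 0)) (a b : ℝ)
    {c t α β : ℕ → ℝ} (hc : ∀ ν, c ν = √(x ν ^ 3 / (45 * C.descFactorial 3 * N ν)))
    (ht : ∀ ν, t ν = √((C - 2) / x ν))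
    (hα : ∀ ν, α ν = c ν * (a * (1 + 12 / 5 * t ν) + b * (2 - 6 / 5 * t ν)))
    (hβ : ∀ ν, β ν = c ν * (a * (2 - 6 / 5 * t ν) + b * (4 + 3 / 5 * t ν)))
    (htlim : Tendsto t atTop (nhds 0)) {j : ℕ} (hj : j ≤ C) :
    Tendsto (fun ν => √(N ν * holeProb C (x ν) j) * holeWeight (α ν) (β ν) j) atTop
      (nhds (limitWeight a b j)) := by
  have hNr : ∀ ν, (0 : ℝ) < N ν := fun ν => Nat.cast_pos.2 (hNpos ν)
  have hC3 : (3 : ℝ) ≤ C := by exact_mod_cast hC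
  have hK : (C.descFactorial 3 : ℝ) = C.descFactorial 2 * (C - 2) := by
    rw [Nat.descFactorial_succ C 2]
    push_cast [Nat.cast_sub (show 2 ≤ C by omega)]
    ring
  have hKpos : (0 : ℝ) < C.descFactorial 3 := by exact_mod_cast Nat.descFactorial_pos.2 hC
  have h2pos : (0 : ℝ) < C.descFactorial 2 := by
    exact_mod_cast Nat.descFactorial_pos.2 (by omega : 2 ≤ C)
  have hmul : ∀ ν, √(N ν * holeProb C (x ν) j) * c ν =
      √(holeProb C (x ν) 0 * C.descFactorial j * ((x ν)⁻¹ ^ j * x ν ^ 3) /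
        (45 * C.descFactorial 3)) := by
    intro ν
    have h1 := holeProb_nonneg C (hx ν) j
    have := hNr ν
    rw [hc, ← Real.sqrt_mul (by positivity)]
    congr 1
    rw [holeProb_eq hj (hx ν)]
    field_simp
  have hαβ : ∀ ν, β ν - 2 * α ν = c ν * t ν * (3 * (b - 2 * a)) := fun ν => by
    rw [hα, hβ]; ring
  rcases lt_trichotomy j 2 with h | rfl | h
  · have hl : limitWeight a b j = 0 := by
      rw [limitWeight, if_neg (by omega), if_neg (by omega)]
    rw [hl]
    refine tendsto_const_nhds.congr fun ν => ?_
    interval_cases j <;> simp [holeWeight]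
  · have hl : limitWeight a b 2 = √(1 / 45) * (3 * (b - 2 * a)) := by simp [limitWeight]
    rw [hl]
    have h := ((hp0.div_const 45).sqrt).mul_const (3 * (b - 2 * a))
    refine h.congr fun ν => ?_
    have hw : holeWeight (α ν) (β ν) 2 = β ν - 2 * α ν := by
      simp [holeWeight]; ring
    rw [hw, hαβ, ← mul_assoc (√(N ν * holeProb C (x ν) 2)) (c ν * t ν), ← mul_assoc (√(N ν * holeProb C (x ν) 2)), hmul, ht]
    congr 1
    have h0 := holeProb_zero_pos C (hx ν)
    have hxν := hx ν
    have h2 : (C : ℝ) - 2 ≠ 0 := by linarith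
    rw [← Real.sqrt_mul (by positivity)]
    congr 1
    rw [hK]
    field_simp
  · have hw : ∀ ν, holeWeight (α ν) (β ν) j =
        c ν * (-j * (a * (1 + 12 / 5 * t ν) + b * (2 - 6 / 5 * t ν))) := fun ν => by
      rw [holeWeight, if_neg (by omega), if_neg (by omega), hα]; ring
    have hlin : Tendsto (fun ν => -(j : ℝ) * (a * (1 + 12 / 5 * t ν) + b * (2 - 6 / 5 * t ν)))
        atTop (nhds (-(j : ℝ) * (a * (1 + 12 / 5 * 0) + b * (2 - 6 / 5 * 0)))) :=
      (((((htlim.const_mul _).const_add _).const_mul _).add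
        (((htlim.const_mul _).const_sub _).const_mul _)).const_mul _)
    have hs : Tendsto (fun ν => √(N ν * holeProb C (x ν) j) * c ν) atTop
        (nhds √(1 * C.descFactorial j * 0 ^ (j - 3) / (45 * C.descFactorial 3))) := by
      have h := (((hp0.mul_const (C.descFactorial j : ℝ)).mul (hinv.pow (j - 3))).div_const
        (45 * C.descFactorial 3 : ℝ)).sqrt
      refine h.congr fun ν => ?_
      rw [hmul]
      congr 4
      have := hx ν
      obtain ⟨i, rfl⟩ := Nat.exists_eq_add_of_le' (show 3 ≤ j by omega)
      rw [Nat.add_sub_cancel, pow_add (x ν)⁻¹, mul_assoc, ← mul_pow, inv_mul_cancel₀ this.ne',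
        one_pow, mul_one]
    have h := hs.mul hlin
    have hl : limitWeight a b j = √(1 * C.descFactorial j * 0 ^ (j - 3) / (45 * C.descFactorial 3)) *
        (-(j : ℝ) * (a * (1 + 12 / 5 * 0) + b * (2 - 6 / 5 * 0))) := by
      rcases eq_or_lt_of_le (show 3 ≤ j by omega) with rfl | h3
      · rw [limitWeight, if_neg (by omega), if_pos rfl]
        congr 2
        · field_simp
          simp
        · ring
      · rw [limitWeight, if_neg (by omega), if_neg (by omega), zero_pow (by omega)]
        simp
    rw [hl]
    refine h.congr fun ν => ?_
    rw [hw, mul_assoc]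

/-- **Theorem (joint CLT for the numbers of bins containing `C−1` and `C−2` balls).**
Fix `C ≥ 3`.  With `N → ∞`, `n ≤ CN − 1`, `CN − n = o(N)`, `λ₀ = o(N^{1/7})` the unique
positive solution of `λ g'(λ)/g(λ) = n/N`, `μ₁ = N λ₀^{C−1}/(g(λ₀)(C−1)!)`,
`μ₂ = N λ₀^{C−2}/(g(λ₀)(C−2)!)` and the explicit `2×2` matrix
`A_ν = (λ₀^{3/2}/(3 √(5 C(C−1)(C−2) N))) · [[1 + 12√(C−2)/(5√λ₀), 2 − 6√(C−2)/(5√λ₀)],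
[2 − 6√(C−2)/(5√λ₀), 4 + 3√(C−2)/(5√λ₀)]]`, in the uniform allocation model the vector
`A_ν ((X_{C−1}, X_{C−2}) − (μ₁, μ₂))` converges in distribution to `N(0, I₂)`. -/
theorem statement16 (C : ℕ) (hC : 3 ≤ C)
    (n N : ℕ → ℕ) (hNpos : ∀ ν, 0 < N ν)
    (hN : Tendsto N atTop atTop)
    (hhigh : ∀ ν, n ν ≤ C * N ν - 1)
    (hgap : Tendsto (fun ν => ((C * N ν - n ν : ℕ) : ℝ) / N ν) atTop (nhds 0))
    (lam0 : ℕ → ℝ) (hlam0pos : ∀ ν, 0 < lam0 ν)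
    (hlam0 : ∀ ν, lam0 ν * deriv (gfun C) (lam0 ν) / gfun C (lam0 ν) = (n ν : ℝ) / N ν)
    (hlamN : Tendsto (fun ν => lam0 ν / (N ν : ℝ) ^ ((1 : ℝ) / 7)) atTop (nhds 0))
    (μ₁ μ₂ : ℕ → ℝ)
    (hμ₁ : ∀ ν, μ₁ ν = (N ν : ℝ) * lam0 ν ^ (C - 1) / (gfun C (lam0 ν) * Nat.factorial (C - 1)))
    (hμ₂ : ∀ ν, μ₂ ν = (N ν : ℝ) * lam0 ν ^ (C - 2) / (gfun C (lam0 ν) * Nat.factorial (C - 2)))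
    (A : ℕ → Matrix (Fin 2) (Fin 2) ℝ)
    (hA : ∀ ν, A ν =
      (lam0 ν ^ ((3 : ℝ) / 2) /
          (3 * Real.sqrt (5 * C * ((C : ℝ) - 1) * ((C : ℝ) - 2) * N ν))) •
        !![1 + 12 * Real.sqrt ((C : ℝ) - 2) / (5 * Real.sqrt (lam0 ν)),
            2 - 6 * Real.sqrt ((C : ℝ) - 2) / (5 * Real.sqrt (lam0 ν));
           2 - 6 * Real.sqrt ((C : ℝ) - 2) / (5 * Real.sqrt (lam0 ν)),
            4 + 3 * Real.sqrt ((C : ℝ) - 2) / (5 * Real.sqrt (lam0 ν))]) :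
    ∀ φ : BoundedContinuousFunction (Fin 2 → ℝ) ℝ,
      Tendsto (fun ν =>
          (∑ f ∈ validPlacements (n ν) (N ν) C,
              φ ((A ν) *ᵥ
                ![(binCount f (C - 1) : ℝ) - μ₁ ν, (binCount f (C - 2) : ℝ) - μ₂ ν])) /
            ((validPlacements (n ν) (N ν) C).card : ℝ))
        atTop (nhds (∫ x, φ x ∂ stdGaussian 2)) := by
  have hNr : ∀ ν, (0 : ℝ) < N ν := fun ν => Nat.cast_pos.2 (hNpos ν)
  have hC3 : (3 : ℝ) ≤ C := by exact_mod_cast hC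
  have hle : ∀ ν, n ν ≤ C * N ν := fun ν => (hhigh ν).trans (Nat.sub_le _ _)
  have hgap' : Tendsto (fun ν => (C : ℝ) - (n ν : ℝ) / N ν) atTop (nhds 0) := by
    refine hgap.congr fun ν => ?_
    have := (hNr ν).ne'
    rw [Nat.cast_sub (hle ν)]
    push_cast
    field_simp
  have hmean : ∀ ν, ∑ j ∈ Finset.range (C + 1), holeProb C (lam0 ν) j * j =
      C - (n ν : ℝ) / N ν := fun ν => by rw [sum_holeProb_mul C (hlam0pos ν), hlam0]
  have hm : Tendsto (fun ν => ∑ j ∈ Finset.range (C + 1), holeProb C (lam0 ν) j * j) atTop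
      (nhds 0) := hgap'.congr fun ν => (hmean ν).symm
  have hinv := tendsto_inv_of_tendsto_sum_holeProb (by omega) hlam0pos hm
  have hp0 := tendsto_holeProb_zero hlam0pos hm
  have hx1 := tendsto_pow_div_of_tendsto_div_rpow hlam0pos hinv hlamN (k := 1) (by norm_num)
  have hx3 := tendsto_pow_div_of_tendsto_div_rpow hlam0pos hinv hlamN (k := 3) (by norm_num)
  simp only [pow_one] at hx1
  have hK : (C.descFactorial 3 : ℝ) = C * (C - 1) * (C - 2) := by
    simp only [Nat.descFactorial_succ, Nat.descFactorial_zero, Nat.sub_zero]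
    push_cast [Nat.cast_sub (show 2 ≤ C by omega), Nat.cast_sub (show 1 ≤ C by omega)]
    ring
  set c : ℕ → ℝ := fun ν => √(lam0 ν ^ 3 / (45 * C.descFactorial 3 * N ν)) with hc
  set t : ℕ → ℝ := fun ν => √((C - 2) / lam0 ν) with ht
  have htlim : Tendsto t atTop (nhds 0) := by
    have h := (hinv.const_mul ((C : ℝ) - 2)).sqrt
    simpa [ht, div_eq_mul_inv] using h
  have hclim : Tendsto c atTop (nhds 0) := by
    have h := (hx3.div_const (45 * C.descFactorial 3 : ℝ)).sqrt
    rw [zero_div, Real.sqrt_zero] at h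
    refine h.congr fun ν => ?_
    rw [hc, div_div, mul_comm (N ν : ℝ)]
  have hA' : ∀ ν, A ν = c ν • !![1 + 12 / 5 * t ν, 2 - 6 / 5 * t ν;
      2 - 6 / 5 * t ν, 4 + 3 / 5 * t ν] := by
    intro ν
    have h := rpow_three_halves_div (K := C.descFactorial 3) (N := N ν) (hlam0pos ν)
    rw [hA, hc, ht]
    simp only
    rw [← h, Real.sqrt_div (by linarith), hK]
    simp only [mul_div_mul_comm, mul_assoc]
  refine tendsto_average_of_tendsto_charFun
    (fun ν => validPlacements (n ν) (N ν) C) (fun ν => validPlacements_nonempty (hle ν))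
    (fun ν f => A ν *ᵥ ![(binCount f (C - 1) : ℝ) - μ₁ ν, (binCount f (C - 2) : ℝ) - μ₂ ν])
    fun a b => ?_
  set α : ℕ → ℝ := fun ν => c ν * (a * (1 + 12 / 5 * t ν) + b * (2 - 6 / 5 * t ν)) with hα
  set β : ℕ → ℝ := fun ν => c ν * (a * (2 - 6 / 5 * t ν) + b * (4 + 3 / 5 * t ν)) with hβ
  have hαlim : Tendsto α atTop (nhds 0) := by
    have h := hclim.mul (((htlim.const_mul (12 / 5)).const_add 1 |>.const_mul a).add
      ((htlim.const_mul (6 / 5)).const_sub 2 |>.const_mul b))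
    rwa [zero_mul] at h
  have hβlim : Tendsto β atTop (nhds 0) := by
    have h := hclim.mul (((htlim.const_mul (6 / 5)).const_sub 2 |>.const_mul a).add
      ((htlim.const_mul (3 / 5)).const_add 4 |>.const_mul b))
    rwa [zero_mul] at h
  have hℓ : ∀ j ≤ C, Tendsto (fun ν => holeWeight (α ν) (β ν) j) atTop (nhds 0) := by
    intro j _
    have h1 : Tendsto (fun ν => if j = 1 then α ν else 0) atTop (nhds 0) := by
      split_ifs
      exacts [hαlim, tendsto_const_nhds]
    have h2 : Tendsto (fun ν => if j = 2 then β ν else 0) atTop (nhds 0) := by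
      split_ifs
      exacts [hβlim, tendsto_const_nhds]
    simpa [holeWeight] using (h1.add h2).sub (hαlim.mul_const (j : ℝ))
  have h := tendsto_average_exp_binCount hC hNpos hN hlam0pos hmean hgap' hx1 hℓ
    fun j hj => tendsto_sqrt_mul_holeWeight hC hNpos hlam0pos hp0 hinv a b
      (fun _ => rfl) (fun _ => rfl) (fun _ => rfl) (fun _ => rfl) htlim hj
  rw [sum_limitWeight_sq hC] at h
  have hlim : Complex.exp (-(((a ^ 2 + b ^ 2) / 2 : ℝ) : ℂ)) =
      Complex.exp (-((a : ℂ) ^ 2 + (b : ℂ) ^ 2) / 2) := by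
    push_cast
    rw [neg_div]
  rw [hlim] at h
  refine h.congr fun ν => ?_
  congr 1
  refine Finset.sum_congr rfl fun f _ => ?_
  congr 3
  have e1 : (N ν : ℝ) * holeProb C (lam0 ν) 1 = μ₁ ν := by
    rw [hμ₁, holeProb, mul_comm (gfun _ _), mul_div_assoc]
  have e2 : (N ν : ℝ) * holeProb C (lam0 ν) 2 = μ₂ ν := by
    rw [hμ₂, holeProb, mul_comm (gfun _ _), mul_div_assoc]
  rw [e1, e2, hA', hα, hβ]
  simp [Matrix.mulVec, dotProduct, Fin.sum_univ_two]
  ring
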